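/- arXiv:math/0511333 — 2 statements merged into one kernel-verified Lean document; each statement's English description precedes it below -/
import Mathlib

section
/- Let K be a field, let n be a positive integer, let t ∈ K, let x = (x_1, …, x_n) ∈ K^n have pairwise distinct entries, let y = (y_1, …, y_n) ∈ K^n have pairwise distinct entries, and assume x_i ≠ t·y_j for all 1 ≤ i, j ≤ n. Then ω(x, y; t) = (1 − t)^n · Σ_{w ∈ S_n} ∏_{i=1}^{n} y_{w(i)}/(x_i − t·y_{w(i)}) · ∏_{1 ≤ i < j ≤ n} [(x_i − y_{w(j)})/(x_i − t·y_{w(j)})] · [(y_{w(i)} − t·y_{w(j)})/(y_{w(i)} − y_{w(j)})], where S_n is the symmetric group on {1,…,n}. -/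
open Finset

/-- The bisymmetric function `ω(x, y; t)`. -/
noncomputable def bisymOmega {K : Type*} [Field K] {m n : ℕ} (t : K)
    (x : Fin m → K) (y : Fin n → K) : K :=
  ∑ I : Finset (Fin m),
    (-1 : K) ^ I.card * t ^ (I.card.choose 2) *
      (∏ i ∈ I, ∏ j ∈ Iᶜ, (x i - t * x j) / (x i - x j)) *
      (∏ i ∈ I, ∏ j, (x i - y j) / (x i - t * y j))

section Aux
set_option linter.unusedSectionVars false
variable {K ι κ : Type*} [Field K] [DecidableEq ι] [DecidableEq κ]

noncomputable def auxC (t : K) (x g : ι → K) (S J : Finset ι) : K :=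
  (-1 : K) ^ J.card * t ^ (J.card.choose 2) *
    (∏ i ∈ J, ∏ j ∈ S \ J, (x i - t * x j) / (x i - x j)) * ∏ i ∈ J, g i

lemma auxC_insert_not (t : K) (x g : ι → K) (S J : Finset ι) (a : ι) (ha : a ∉ S) (hJ : J ⊆ S) :
    auxC t x g (insert a S) J = auxC t x g S J * ∏ i ∈ J, (x i - t * x a) / (x i - x a) := by
  unfold auxC
  have haJ : a ∉ J := fun h => ha (hJ h)
  rw [Finset.insert_sdiff_of_notMem _ haJ]
  have : ∀ i ∈ J, ∏ j ∈ insert a (S \ J), (x i - t * x j) / (x i - x j) =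
      ((x i - t * x a) / (x i - x a)) * ∏ j ∈ S \ J, (x i - t * x j) / (x i - x j) := by
    intro i _
    rw [Finset.prod_insert (by simp [ha])]
  rw [Finset.prod_congr rfl this, Finset.prod_mul_distrib]
  ring

lemma auxC_insert (t : K) (x g : ι → K) (S J : Finset ι) (a : ι) (ha : a ∉ S) (hJ : J ⊆ S) :
    auxC t x g (insert a S) (insert a J) =
      - t ^ J.card * auxC t x g S J * (∏ j ∈ S \ J, (x a - t * x j) / (x a - x j)) * g a := by
  unfold auxC
  have haJ : a ∉ J := fun h => ha (hJ h)
  have h1 : insert a S \ insert a J = S \ J := by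
    ext b; simp only [Finset.mem_sdiff, Finset.mem_insert]
    constructor
    · tauto
    · rintro ⟨h, h'⟩
      refine ⟨Or.inr h, ?_⟩
      rintro (rfl | h2)
      · exact ha h
      · exact h' h2
  rw [h1, Finset.prod_insert haJ, Finset.prod_insert haJ, Finset.card_insert_of_notMem haJ,
    Nat.choose_succ_succ' J.card 1, pow_succ, pow_add, Nat.choose_one_right]
  ring

open Polynomial in
noncomputable def auxP (t : K) (x : ι → K) (y : κ → K) (S J : Finset ι) (T : Finset κ) : K[X] :=
  (∏ i ∈ J, (C t * X + C (-x i))) * (∏ j ∈ S \ J, (C 1 * X + C (-x j))) *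
      (∏ j ∈ T, (C 1 * X + C (-(t * y j)))) -
  C (t ^ J.card) * ((∏ j ∈ S \ J, (C 1 * X + C (-(t * x j)))) * (∏ i ∈ J, (C 1 * X + C (-x i))) *
      (∏ j ∈ T, (C 1 * X + C (-y j))))

open Polynomial in
lemma auxP_degree (t : K) (ht : t ≠ 0) (x : ι → K) (y : κ → K) (S J : Finset ι) (T : Finset κ)
    (hJ : J ⊆ S) : (auxP t x y S J T).degree < ((S.card + T.card : ℕ) : WithBot ℕ) := by
  have hc : J.card + (S \ J).card = S.card := by
    rw [add_comm]; exact Finset.card_sdiff_add_card_eq_card hJ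
  have d1 : ((∏ i ∈ J, (C t * X + C (-x i))) * (∏ j ∈ S \ J, (C 1 * X + C (-x j))) *
      (∏ j ∈ T, (C 1 * X + C (-(t * y j))))).degree = ((S.card + T.card : ℕ) : WithBot ℕ) := by
    simp only [degree_mul, degree_prod, degree_linear ht, degree_linear (one_ne_zero (α := K))]
    simp [← hc]
  have d2 : (C (t ^ J.card) * ((∏ j ∈ S \ J, (C 1 * X + C (-(t * x j)))) *
      (∏ i ∈ J, (C 1 * X + C (-x i))) * (∏ j ∈ T, (C 1 * X + C (-y j))))).degree
        = ((S.card + T.card : ℕ) : WithBot ℕ) := by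
    simp only [degree_mul, degree_prod, degree_linear (one_ne_zero (α := K)),
      degree_C (pow_ne_zero _ ht)]
    simp [← hc, add_comm]
  rw [← d1]
  unfold auxP
  apply degree_sub_lt_left (d1.trans d2.symm)
  · intro h
    rw [h, degree_zero] at d1
    exact WithBot.natCast_ne_bot _ d1.symm
  · simp only [leadingCoeff_mul, leadingCoeff_prod, leadingCoeff_linear ht,
      leadingCoeff_linear (one_ne_zero (α := K)), leadingCoeff_C]
    simp

lemma auxP_eval (t : K) (x : ι → K) (y : κ → K) (S J : Finset ι) (T : Finset κ) (z : K) :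
    (auxP t x y S J T).eval z = (∏ i ∈ J, (t * z - x i)) * (∏ j ∈ S \ J, (z - x j)) *
      (∏ j ∈ T, (z - t * y j)) -
  t ^ J.card * ((∏ j ∈ S \ J, (z - t * x j)) * (∏ i ∈ J, (z - x i)) *
      (∏ j ∈ T, (z - y j))) := by
  simp [auxP, Polynomial.eval_prod, sub_eq_add_neg]

lemma auxP_eval_x (t : K) (x : ι → K) (y : κ → K) (S : Finset ι) (T : Finset κ) (l : ι)
    (hl : l ∉ S) (hx : ∀ i ∈ S, x l ≠ x i) (hxy : ∀ j ∈ T, x l ≠ t * y j) (g : ι → K)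
    (hg : g l = ∏ j ∈ T, (x l - y j) / (x l - t * y j)) :
    ∑ J ∈ (insert l S).powerset, auxC t x g (insert l S) J *
      (auxP t x y (insert l S) J T).eval (x l) = 0 := by
  rw [Finset.sum_powerset_insert hl, ← Finset.sum_add_distrib]
  apply Finset.sum_eq_zero
  intro J hJ
  have hJ := Finset.mem_powerset.1 hJ
  have hlJ : l ∉ J := fun h => hl (hJ h)
  rw [auxC_insert_not _ _ _ _ _ _ hl hJ, auxC_insert _ _ _ _ _ _ hl hJ, auxP_eval, auxP_eval]
  have h1 : insert l S \ insert l J = S \ J := by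
    ext b; simp only [Finset.mem_sdiff, Finset.mem_insert]
    constructor
    · tauto
    · rintro ⟨h, h'⟩
      refine ⟨Or.inr h, ?_⟩
      rintro (rfl | h2)
      · exact hl h
      · exact h' h2
  rw [h1, Finset.insert_sdiff_of_notMem _ hlJ, Finset.prod_insert hlJ, Finset.prod_insert hlJ,
    Finset.prod_insert (by simp [hl]), Finset.prod_insert (by simp [hl]), hg]
  have e1 : (∏ i ∈ J, (x i - t * x l) / (x i - x l)) * ∏ i ∈ J, (x l - x i)
      = ∏ i ∈ J, (t * x l - x i) := by
    rw [← Finset.prod_mul_distrib]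
    apply Finset.prod_congr rfl
    intro i hi
    have := sub_ne_zero.2 (hx i (hJ hi)).symm
    field_simp
    ring
  have e2 : (∏ j ∈ S \ J, (x l - t * x j) / (x l - x j)) * ∏ j ∈ S \ J, (x l - x j)
      = ∏ j ∈ S \ J, (x l - t * x j) := by
    rw [← Finset.prod_mul_distrib]
    apply Finset.prod_congr rfl
    intro i hi
    have := sub_ne_zero.2 (hx i (Finset.mem_sdiff.1 hi).1)
    field_simp
  have e3 : (∏ j ∈ T, (x l - y j) / (x l - t * y j)) * ∏ j ∈ T, (x l - t * y j)
      = ∏ j ∈ T, (x l - y j) := by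
    rw [← Finset.prod_mul_distrib]
    apply Finset.prod_congr rfl
    intro i hi
    exact div_mul_cancel₀ _ (sub_ne_zero.2 (hxy i hi))
  rw [← e1, ← e2, ← e3]
  ring

/-- the residue -/
noncomputable def auxA (t : K) (x : ι → K) (y : κ → K) (S : Finset ι) (T : Finset κ) (k : κ) : K :=
  (1 - t) * y k * (∏ i ∈ S, (x i - y k) / (x i - t * y k)) *
    (∏ j ∈ T.erase k, (y j - t * y k) / (y j - y k)) *
    ∑ J ∈ S.powerset, auxC t x (fun i => ∏ j ∈ T.erase k, (x i - y j) / (x i - t * y j)) S J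

lemma auxP_eval_y (t : K) (x : ι → K) (y : κ → K) (S : Finset ι) (T : Finset κ) (k : κ)
    (hk : k ∈ T) (hcard : S.card + 1 = T.card)
    (hy : ∀ j ∈ T.erase k, y j ≠ y k) (hxy : ∀ i ∈ S, x i ≠ t * y k) :
    ∑ J ∈ S.powerset, auxC t x (fun i => ∏ j ∈ T, (x i - y j) / (x i - t * y j)) S J *
      (auxP t x y S J T).eval (t * y k) =
    auxA t x y S T k * ((∏ j ∈ T.erase k, (t * y k - t * y j)) * ∏ i ∈ S, (t * y k - x i)) := by
  unfold auxA
  rw [mul_assoc, Finset.sum_mul, Finset.mul_sum]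
  apply Finset.sum_congr rfl
  intro J hJ
  have hJ := Finset.mem_powerset.1 hJ
  have hcJ : (T.erase k).card = J.card + (S \ J).card := by
    rw [Finset.card_erase_of_mem hk, add_comm, Finset.card_sdiff_add_card_eq_card hJ]; omega
  rw [auxP_eval, Finset.prod_eq_zero hk (sub_self (t * y k)), mul_zero, zero_sub]
  have hT := Finset.insert_erase hk
  set T' := T.erase k with hT'
  have hk' : k ∉ T' := by simp [hT']
  rw [← hT]
  simp only [auxC, Finset.prod_insert hk']
  rw [Finset.prod_mul_distrib]
  have s : ∀ f : ι → K, ∏ i ∈ S, f i = (∏ i ∈ J, f i) * ∏ i ∈ S \ J, f i := fun f => by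
    rw [mul_comm, Finset.prod_sdiff hJ]
  rw [s, s]
  have e1 : (∏ j ∈ T', (y j - t * y k) / (y j - y k)) * ∏ j ∈ T', (t * y k - t * y j)
      = t ^ J.card * t ^ (S \ J).card * ∏ j ∈ T', (t * y k - y j) := by
    rw [← pow_add, ← hcJ, ← Finset.prod_const, ← Finset.prod_mul_distrib, ← Finset.prod_mul_distrib]
    apply Finset.prod_congr rfl
    intro j hj
    have := sub_ne_zero.2 (hy j hj)
    field_simp
    ring
  have e2 : (∏ i ∈ S \ J, (x i - y k) / (x i - t * y k)) * (t ^ (S \ J).card *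
      ∏ i ∈ S \ J, (t * y k - x i)) = ∏ i ∈ S \ J, (t * y k - t * x i) := by
    rw [← Finset.prod_const, ← Finset.prod_mul_distrib, ← Finset.prod_mul_distrib]
    apply Finset.prod_congr rfl
    intro j hj
    rw [div_mul_eq_mul_div, div_eq_iff (sub_ne_zero.2 (hxy j (Finset.mem_sdiff.1 hj).1))]
    ring
  rw [← e2]
  generalize (∏ i ∈ S \ J, (x i - y k) / (x i - t * y k)) = a1 at *
  generalize (∏ j ∈ T', (y j - t * y k) / (y j - y k)) = a2 at *
  generalize ∏ j ∈ T', (t * y k - t * y j) = a3 at *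
  linear_combination (-(-1) ^ J.card * t ^ J.card.choose 2 * (∏ i ∈ J, ∏ j ∈ S \ J, (x i - t * x j) / (x i - x j)) *
        ((∏ i ∈ J, (x i - y k) / (x i - t * y k)) * ∏ i ∈ J, ∏ x_1 ∈ T', (x i - y x_1) / (x i - t * y x_1)) * (1 - t) * y k * a1 * (∏ i ∈ S \ J, (t * y k - x i)) * ∏ i ∈ J, (t * y k - x i)) * e1

open Polynomial in
lemma aux_poly (t : K) (ht : t ≠ 0) (x : ι → K) (y : κ → K) (S : Finset ι) (T : Finset κ)
    (hcard : S.card + 1 = T.card) (hx : Set.InjOn x S) (hy : Set.InjOn y T)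
    (hxy : ∀ i ∈ S, ∀ j ∈ T, x i ≠ t * y j) :
    ∑ J ∈ S.powerset, C (auxC t x (fun i => ∏ j ∈ T, (x i - y j) / (x i - t * y j)) S J) *
      auxP t x y S J T =
    ∑ k ∈ T, C (auxA t x y S T k) * ((∏ j ∈ T.erase k, (X - C (t * y j))) *
      ∏ i ∈ S, (X - C (x i))) := by
  classical
  have hN : (S.image x ∪ T.image (fun j => t * y j)).card = S.card + T.card := by
    rw [Finset.card_union_of_disjoint, Finset.card_image_of_injOn hx, Finset.card_image_of_injOn]
    · intro a ha b hb h
      exact hy ha hb (mul_left_cancel₀ ht h)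
    · rw [Finset.disjoint_left]
      simp only [Finset.mem_image, not_exists, not_and]
      rintro _ ⟨i, hi, rfl⟩ j hj h
      exact hxy i hi j hj h.symm
  apply Polynomial.eq_of_degrees_lt_of_eval_finset_eq (S.image x ∪ T.image (fun j => t * y j))
  · rw [hN]
    rw [← mem_degreeLT]
    apply Submodule.sum_mem
    intro J hJ
    rw [← smul_eq_C_mul]
    apply Submodule.smul_mem
    rw [mem_degreeLT]
    exact auxP_degree t ht x y S J T (Finset.mem_powerset.1 hJ)
  · rw [hN]
    rw [← mem_degreeLT]
    apply Submodule.sum_mem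
    intro k hk
    rw [← smul_eq_C_mul]
    apply Submodule.smul_mem
    rw [mem_degreeLT, degree_mul, degree_prod, degree_prod]
    simp only [degree_X_sub_C, Finset.sum_const, Finset.card_erase_of_mem hk]
    simp only [nsmul_eq_mul, mul_one]
    norm_cast
    omega
  · intro z hz
    simp only [eval_finsetSum, eval_mul, eval_C, eval_prod, eval_sub, eval_X]
    rw [Finset.mem_union, Finset.mem_image, Finset.mem_image] at hz
    rcases hz with ⟨l, hl, rfl⟩ | ⟨k, hk, rfl⟩
    · rw [Finset.sum_eq_zero (s := T)]
      · have := auxP_eval_x t x y (S.erase l) T l (by simp)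
          (fun i hi h => (Finset.mem_erase.1 hi).1 (hx hl (Finset.mem_erase.1 hi).2 h).symm)
          (hxy l hl) (fun i => ∏ j ∈ T, (x i - y j) / (x i - t * y j)) rfl
        rwa [Finset.insert_erase hl] at this
      · intro k _
        rw [Finset.prod_eq_zero hl (sub_self (x l))]
        simp
    · rw [auxP_eval_y t x y S T k hk hcard
        (fun j hj h => (Finset.mem_erase.1 hj).1 (hy (Finset.mem_erase.1 hj).2 hk h))
        (fun i hi => hxy i hi k hk)]
      symm
      apply Finset.sum_eq_single_of_mem k hk
      intro j hj hjk
      rw [Finset.prod_eq_zero (Finset.mem_erase.2 ⟨hjk.symm, hk⟩) (sub_self _)]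
      simp

lemma aux_rec (t : K) (ht : t ≠ 0) (x : ι → K) (y : κ → K) (S : Finset ι) (T : Finset κ) (a : ι)
    (ha : a ∉ S)
    (hcard : S.card + 1 = T.card) (hx : Set.InjOn x (insert a S : Finset ι)) (hy : Set.InjOn y T)
    (hxy : ∀ i ∈ insert a S, ∀ j ∈ T, x i ≠ t * y j) :
    ∑ J ∈ (insert a S).powerset,
      auxC t x (fun i => ∏ j ∈ T, (x i - y j) / (x i - t * y j)) (insert a S) J =
    ∑ k ∈ T, auxA t x y S T k / (x a - t * y k) := by
  have hxa : ∀ i ∈ S, x a - x i ≠ 0 := fun i hi h => by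
    have := hx (by simp) (by simp [hi]) (sub_eq_zero.1 h)
    exact ha (this ▸ hi)
  have hya : ∀ j ∈ T, x a - t * y j ≠ 0 := fun j hj => sub_ne_zero.2 (hxy a (by simp) j hj)
  have key := congrArg (Polynomial.eval (x a)) (aux_poly t ht x y S T hcard
    (hx.mono (by simp)) hy (fun i hi => hxy i (by simp [hi])))
  simp only [Polynomial.eval_finsetSum, Polynomial.eval_mul, Polynomial.eval_C,
    Polynomial.eval_prod, Polynomial.eval_sub, Polynomial.eval_X] at key
  have hD : (∏ i ∈ S, (x a - x i)) * ∏ j ∈ T, (x a - t * y j) ≠ 0 :=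
    mul_ne_zero (Finset.prod_ne_zero_iff.2 hxa) (Finset.prod_ne_zero_iff.2 hya)
  apply mul_right_cancel₀ hD
  rw [Finset.sum_powerset_insert ha, ← Finset.sum_add_distrib, Finset.sum_mul, Finset.sum_mul]
  refine Eq.trans ?_ (key.trans ?_)
  · apply Finset.sum_congr rfl
    intro J hJ
    have hJ := Finset.mem_powerset.1 hJ
    rw [auxC_insert_not _ _ _ _ _ _ ha hJ, auxC_insert _ _ _ _ _ _ ha hJ, auxP_eval]
    have s : ∀ f : ι → K, ∏ i ∈ S, f i = (∏ i ∈ J, f i) * ∏ i ∈ S \ J, f i := fun f => by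
      rw [mul_comm, Finset.prod_sdiff hJ]
    rw [s]
    have e1 : (∏ i ∈ J, (x i - t * x a) / (x i - x a)) * ∏ i ∈ J, (x a - x i)
        = ∏ i ∈ J, (t * x a - x i) := by
      rw [← Finset.prod_mul_distrib]
      apply Finset.prod_congr rfl
      intro i hi
      have := hxa i (hJ hi)
      have h2 : x i - x a ≠ 0 := fun h => this (by linear_combination -h)
      field_simp
      ring
    have e2 : (∏ j ∈ S \ J, (x a - t * x j) / (x a - x j)) * ∏ j ∈ S \ J, (x a - x j)
        = ∏ j ∈ S \ J, (x a - t * x j) := by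
      rw [← Finset.prod_mul_distrib]
      apply Finset.prod_congr rfl
      intro i hi
      have := hxa i (Finset.mem_sdiff.1 hi).1
      field_simp
    have e3 : (∏ j ∈ T, (x a - y j) / (x a - t * y j)) * ∏ j ∈ T, (x a - t * y j)
        = ∏ j ∈ T, (x a - y j) := by
      rw [← Finset.prod_mul_distrib]
      apply Finset.prod_congr rfl
      intro i hi
      exact div_mul_cancel₀ _ (hya i hi)
    rw [← e1, ← e2, ← e3]
    ring
  · apply Finset.sum_congr rfl
    intro k hk
    rw [← Finset.mul_prod_erase T _ hk]
    have := hya k hk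
    field_simp
end Aux

lemma bisymOmega_eq_aux {K : Type*} [Field K] {m n : ℕ} (t : K) (x : Fin m → K) (y : Fin n → K) :
    bisymOmega t x y = ∑ J ∈ (Finset.univ : Finset (Fin m)).powerset,
      auxC t x (fun i => ∏ j, (x i - y j) / (x i - t * y j)) Finset.univ J := by
  unfold bisymOmega auxC
  simp only [Finset.powerset_univ, Finset.compl_eq_univ_sdiff]

lemma auxC_map {K ι κ : Type*} [Field K] [DecidableEq ι] [DecidableEq κ] (t : K) (x g : ι → K)
    (e : κ ↪ ι) (S J : Finset κ) :
    auxC t x g (S.map e) (J.map e) = auxC t (x ∘ e) (g ∘ e) S J := by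
  unfold auxC
  rw [← Finset.map_sdiff]
  simp [Finset.prod_map]

lemma sum_auxC_map {K ι κ : Type*} [Field K] [DecidableEq ι] [DecidableEq κ] (t : K) (x g : ι → K)
    (e : κ ↪ ι) (S : Finset κ) :
    ∑ J ∈ (S.map e).powerset, auxC t x g (S.map e) J =
      ∑ J ∈ S.powerset, auxC t (x ∘ e) (g ∘ e) S J := by
  symm
  apply Finset.sum_bij (fun J _ => J.map e)
  · intro J hJ
    simpa using hJ
  · intro J _ J' _ h
    exact Finset.map_injective e h
  · intro J hJ
    obtain ⟨u, hu, rfl⟩ := Finset.subset_map_iff.1 (Finset.mem_powerset.1 hJ)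
    exact ⟨u, Finset.mem_powerset.2 hu, rfl⟩
  · intro J _
    rw [auxC_map]

lemma univ_erase_succAbove {n : ℕ} (k : Fin (n + 1)) :
    (Finset.univ : Finset (Fin (n + 1))).erase k = Finset.univ.map k.succAboveEmb := by
  ext j
  simp [Fin.exists_succAbove_eq_iff]

lemma univ_insert_last {n : ℕ} :
    (Finset.univ : Finset (Fin (n + 1))) =
      insert (Fin.last n) (Finset.univ.map Fin.castSuccEmb) := by
  ext j
  refine ⟨fun _ => ?_, fun _ => Finset.mem_univ _⟩
  induction j using Fin.lastCases <;> simp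

lemma bisymOmega_rec {K : Type*} [Field K] {n : ℕ} (t : K) (ht : t ≠ 0)
    (x y : Fin (n + 1) → K)
    (hx : Function.Injective x) (hy : Function.Injective y)
    (hxy : ∀ i j, x i ≠ t * y j) :
    bisymOmega t x y = ∑ k, (1 - t) * y k / (x (Fin.last n) - t * y k) *
      (∏ i : Fin n, (x i.castSucc - y k) / (x i.castSucc - t * y k)) *
      (∏ j : Fin n, (y (k.succAbove j) - t * y k) / (y (k.succAbove j) - y k)) *
      bisymOmega t (fun i => x i.castSucc) (fun j => y (k.succAbove j)) := by
  have h := aux_rec t ht x y (Finset.univ.map Fin.castSuccEmb) Finset.univ (Fin.last n)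
    (by simp) (by simp) hx.injOn hy.injOn (fun i _ j _ => hxy i j)
  rw [← univ_insert_last] at h
  rw [bisymOmega_eq_aux, h]
  apply Finset.sum_congr rfl
  intro k _
  unfold auxA
  rw [sum_auxC_map, bisymOmega_eq_aux, univ_erase_succAbove]
  simp only [Finset.prod_map, Function.comp_def]
  simp only [Fin.coe_castSuccEmb, Fin.coe_succAboveEmb]
  ring

/-- glue a permutation -/
noncomputable def auxGlue {n : ℕ} (p : Fin (n + 1) × Equiv.Perm (Fin n)) :
    Equiv.Perm (Fin (n + 1)) :=
  Equiv.ofBijective (Fin.snoc (α := fun _ => Fin (n + 1)) (fun i => p.1.succAbove (p.2 i)) p.1) (by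
    rw [Fintype.bijective_iff_injective_and_card]
    refine ⟨?_, rfl⟩
    intro i j
    induction i using Fin.lastCases <;> induction j using Fin.lastCases <;>
      simp [Fin.succAbove_ne, (Fin.succAbove_ne _ _).symm])

lemma auxGlue_last {n : ℕ} (p : Fin (n + 1) × Equiv.Perm (Fin n)) :
    auxGlue p (Fin.last n) = p.1 := by
  simp [auxGlue]

lemma auxGlue_castSucc {n : ℕ} (p : Fin (n + 1) × Equiv.Perm (Fin n)) (i : Fin n) :
    auxGlue p i.castSucc = p.1.succAbove (p.2 i) := by
  simp [auxGlue]

lemma auxGlue_bijective {n : ℕ} : Function.Bijective (auxGlue (n := n)) := by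
  rw [Fintype.bijective_iff_injective_and_card]
  constructor
  · rintro ⟨k, w⟩ ⟨k', w'⟩ h
    have h1 : k = k' := by
      have := congrArg (fun e => e (Fin.last n)) h
      simpa [auxGlue_last] using this
    subst h1
    congr 1
    ext i
    have := congrArg (fun e => e i.castSucc) h
    simp only [auxGlue_castSucc] at this
    rw [Fin.succAbove_right_injective this]
  · simp [Fintype.card_perm, Nat.factorial_succ]

lemma prod_Ioi_castSucc {K : Type*} [Field K] {n : ℕ} (f : Fin (n + 1) → K) (i : Fin n) :
    ∏ j ∈ Finset.Ioi i.castSucc, f j = (∏ j ∈ Finset.Ioi i, f j.castSucc) * f (Fin.last n) := by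
  have : Finset.Ioi i.castSucc =
      insert (Fin.last n) ((Finset.Ioi i).map Fin.castSuccEmb) := by
    ext j
    induction j using Fin.lastCases <;> simp [Fin.castSucc_lt_last, Fin.le_last]
  rw [this, Finset.prod_insert (by simp), Finset.prod_map, mul_comm]
  rfl

lemma bisymOmega_symmetric_sum_aux {K : Type*} [Field K] (t : K) (ht : t ≠ 0) (n : ℕ) :
    ∀ (x y : Fin n → K)
    (_ : Function.Injective x) (_ : Function.Injective y)
    (_ : ∀ i j : Fin n, x i ≠ t * y j),
    bisymOmega t x y =
      (1 - t) ^ n *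
        ∑ w : Equiv.Perm (Fin n),
          (∏ i : Fin n, y (w i) / (x i - t * y (w i))) *
          ∏ i : Fin n, ∏ j ∈ Finset.Ioi i,
            ((x i - y (w j)) / (x i - t * y (w j))) *
            ((y (w i) - t * y (w j)) / (y (w i) - y (w j))) := by
  induction n with
  | zero =>
    intro x y _ _ _
    unfold bisymOmega
    have h0 : (Finset.univ : Finset (Finset (Fin 0))) = {∅} := rfl
    rw [h0, Finset.sum_singleton]
    simp
  | succ n ih =>
    intro x y hx hy hxy
    rw [bisymOmega_rec t ht x y hx hy hxy, ← auxGlue_bijective.sum_comp, Fintype.sum_prod_type,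
      Finset.mul_sum]
    apply Finset.sum_congr rfl
    intro k _
    rw [ih (fun i => x i.castSucc) (fun j => y (k.succAbove j)) (hx.comp (Fin.castSucc_injective n)) (hy.comp (Fin.succAbove_right_injective (p := k)))
      (fun i j => hxy _ _), ← mul_assoc, Finset.mul_sum, Finset.mul_sum]
    apply Finset.sum_congr rfl
    intro w _
    simp only [Function.comp_def, Fin.prod_univ_castSucc, prod_Ioi_castSucc, auxGlue_last, auxGlue_castSucc]
    have : Finset.Ioi (Fin.last n) = ∅ := by ext j; simp [Fin.le_last]
    rw [this, Finset.prod_empty]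
    simp only [Finset.prod_mul_distrib]
    rw [← Equiv.prod_comp w (fun j => (y (k.succAbove j) - t * y k) / (y (k.succAbove j) - y k))]
    ring

section Spec
variable {K : Type*} [Field K]

/-- `a` specializes to `b` at `0`. -/
def Spc (a : RatFunc K) (b : K) : Prop :=
  ∃ p q : Polynomial K, q.eval 0 ≠ 0 ∧ a * algebraMap _ (RatFunc K) q = algebraMap _ (RatFunc K) p ∧
    b * q.eval 0 = p.eval 0

lemma Spc.C (b : K) : Spc (RatFunc.C b) b :=
  ⟨Polynomial.C b, 1, by simp, by simp, by simp⟩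

lemma Spc.X : Spc (RatFunc.X : RatFunc K) 0 :=
  ⟨Polynomial.X, 1, by simp, by simp, by simp⟩

lemma Spc.one : Spc (1 : RatFunc K) 1 := ⟨1, 1, by simp, by simp, by simp⟩
lemma Spc.zero : Spc (0 : RatFunc K) 0 := ⟨0, 1, by simp, by simp, by simp⟩

lemma Spc.mul {a a' : RatFunc K} {b b' : K} (h : Spc a b) (h' : Spc a' b') :
    Spc (a * a') (b * b') := by
  obtain ⟨p, q, hq, h1, h2⟩ := h
  obtain ⟨p', q', hq', h1', h2'⟩ := h'
  refine ⟨p * p', q * q', by simp [hq, hq'], ?_, ?_⟩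
  · rw [map_mul, map_mul, ← h1, ← h1']; ring
  · rw [Polynomial.eval_mul, Polynomial.eval_mul, ← h2, ← h2']; ring

lemma Spc.sub {a a' : RatFunc K} {b b' : K} (h : Spc a b) (h' : Spc a' b') :
    Spc (a - a') (b - b') := by
  obtain ⟨p, q, hq, h1, h2⟩ := h
  obtain ⟨p', q', hq', h1', h2'⟩ := h'
  refine ⟨p * q' - p' * q, q * q', by simp [hq, hq'], ?_, ?_⟩
  · rw [map_mul, map_sub, map_mul, map_mul, ← h1, ← h1']; ring
  · rw [Polynomial.eval_mul, Polynomial.eval_sub, Polynomial.eval_mul, Polynomial.eval_mul,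
      ← h2, ← h2']; ring

lemma Spc.add {a a' : RatFunc K} {b b' : K} (h : Spc a b) (h' : Spc a' b') :
    Spc (a + a') (b + b') := by
  have := h.sub (Spc.zero.sub h')
  simpa using this

lemma Spc.uniq0 {b : K} (h : Spc 0 b) : b = 0 := by
  obtain ⟨p, q, hq, h1, h2⟩ := h
  rw [zero_mul] at h1
  have : p = 0 := (map_eq_zero_iff _ (RatFunc.algebraMap_injective K)).1 h1.symm
  subst this
  simpa [hq] using h2

lemma Spc.uniq {a : RatFunc K} {b b' : K} (h : Spc a b) (h' : Spc a b') : b = b' := by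
  have := h.sub h'
  rw [sub_self] at this
  exact sub_eq_zero.1 this.uniq0

lemma Spc.ne {a a' : RatFunc K} {b b' : K} (h : Spc a b) (h' : Spc a' b') (hb : b ≠ b') :
    a ≠ a' := by
  rintro rfl
  exact hb (h.uniq h')

lemma Spc.inv {a : RatFunc K} {b : K} (h : Spc a b) (hb : b ≠ 0) : Spc a⁻¹ b⁻¹ := by
  have ha : a ≠ 0 := h.ne Spc.zero hb
  obtain ⟨p, q, hq, h1, h2⟩ := h
  refine ⟨q, p, ?_, ?_, ?_⟩
  · rw [← h2]; exact mul_ne_zero hb hq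
  · rw [← h1]; field_simp
  · rw [← h2]; field_simp

lemma Spc.div {a a' : RatFunc K} {b b' : K} (h : Spc a b) (h' : Spc a' b') (hb : b' ≠ 0) :
    Spc (a / a') (b / b') := by
  rw [div_eq_mul_inv, div_eq_mul_inv]
  exact h.mul (h'.inv hb)

lemma Spc.pow {a : RatFunc K} {b : K} (h : Spc a b) (n : ℕ) : Spc (a ^ n) (b ^ n) := by
  induction n with
  | zero => simpa using Spc.one
  | succ n ih => rw [pow_succ, pow_succ]; exact ih.mul h

lemma Spc.sum {ι : Type*} (s : Finset ι) (f : ι → RatFunc K) (g : ι → K)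
    (h : ∀ i ∈ s, Spc (f i) (g i)) : Spc (∑ i ∈ s, f i) (∑ i ∈ s, g i) := by
  classical
  induction s using Finset.induction_on with
  | empty => simpa using Spc.zero
  | insert a s ha ih =>
    rw [Finset.sum_insert ha, Finset.sum_insert ha]
    exact (h a (by simp)).add (ih fun i hi => h i (by simp [hi]))

lemma Spc.prod {ι : Type*} (s : Finset ι) (f : ι → RatFunc K) (g : ι → K)
    (h : ∀ i ∈ s, Spc (f i) (g i)) : Spc (∏ i ∈ s, f i) (∏ i ∈ s, g i) := by
  classical
  induction s using Finset.induction_on with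
  | empty => simpa using Spc.one
  | insert a s ha ih =>
    rw [Finset.prod_insert ha, Finset.prod_insert ha]
    exact (h a (by simp)).mul (ih fun i hi => h i (by simp [hi]))

lemma Spc.lin {a a' s : RatFunc K} {b b' r : K} (h : Spc a b) (h' : Spc a' b') (hs : Spc s r) :
    Spc (a - s * a') (b - r * b') := h.sub (hs.mul h')

end Spec

/-- The symmetrized expression for `ω(x,y;t)` in the case `m = n`. -/
theorem bisymOmega_symmetric_sum {K : Type*} [Field K] {n : ℕ} (hn : 0 < n) (t : K)
    (x y : Fin n → K)
    (hx : Function.Injective x) (hy : Function.Injective y)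
    (hxy : ∀ i j : Fin n, x i ≠ t * y j) :
    bisymOmega t x y =
      (1 - t) ^ n *
        ∑ w : Equiv.Perm (Fin n),
          (∏ i : Fin n, y (w i) / (x i - t * y (w i))) *
          ∏ i : Fin n, ∏ j ∈ Finset.Ioi i,
            ((x i - y (w j)) / (x i - t * y (w j))) *
            ((y (w i) - t * y (w j)) / (y (w i) - y (w j))) := by
  by_cases ht : t = 0
  swap
  · exact bisymOmega_symmetric_sum_aux t ht n x y hx hy hxy
  have hT : Spc (RatFunc.X : RatFunc K) t := ht ▸ Spc.X
  have hX : ∀ i, Spc (RatFunc.C (x i)) (x i) := fun i => Spc.C _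
  have hY : ∀ i, Spc (RatFunc.C (y i)) (y i) := fun i => Spc.C _
  have key := bisymOmega_symmetric_sum_aux (RatFunc.X : RatFunc K) RatFunc.X_ne_zero n
    (fun i => RatFunc.C (x i)) (fun i => RatFunc.C (y i))
    (fun i j h => hx (RatFunc.C_injective h)) (fun i j h => hy (RatFunc.C_injective h))
    (fun i j => (hX i).ne (hT.mul (hY j)) (hxy i j))
  have hd : ∀ i j, x i - t * y j ≠ 0 := fun i j => sub_ne_zero.2 (hxy i j)
  refine Spc.uniq (a := bisymOmega (RatFunc.X : RatFunc K) (fun i => RatFunc.C (x i))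
    (fun i => RatFunc.C (y i))) ?_ ?_
  · unfold bisymOmega
    refine Spc.sum _ _ _ fun I _ => ?_
    refine Spc.mul (Spc.mul (Spc.mul (Spc.pow ?_ _) (hT.pow _)) ?_) ?_
    · simpa using Spc.zero.sub (Spc.one (K := K))
    · refine Spc.prod _ _ _ fun i hi => Spc.prod _ _ _ fun j hj => ?_
      refine ((hX i).lin (hX j) hT).div ((hX i).sub (hX j)) (sub_ne_zero.2 fun h => ?_)
      rw [hx h] at hi
      exact (Finset.mem_compl.1 hj) hi
    · refine Spc.prod _ _ _ fun i hi => Spc.prod _ _ _ fun j hj => ?_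
      exact ((hX i).sub (hY j)).div ((hX i).lin (hY j) hT) (hd i j)
  · rw [key]
    refine ((Spc.one.sub hT).pow n).mul (Spc.sum _ _ _ fun w _ => ?_)
    refine Spc.mul ?_ ?_
    · exact Spc.prod _ _ _ fun i _ => (hY _).div ((hX i).lin (hY _) hT) (hd _ _)
    · refine Spc.prod _ _ _ fun i hi => Spc.prod _ _ _ fun j hj => ?_
      refine (((hX i).sub (hY _)).div ((hX i).lin (hY _) hT) (hd _ _)).mul
        (((hY _).lin (hY _) hT).div ((hY _).sub (hY _)) (sub_ne_zero.2 fun h => ?_))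
      exact (Finset.mem_Ioi.1 hj).ne (w.injective (hy h))
end

section
/- Let K be a field, let n be a positive integer, let t ∈ K be nonzero, let x = (x_1, …, x_n) ∈ K^n have pairwise distinct nonzero entries, let y = (y_1, …, y_n) ∈ K^n have pairwise distinct nonzero entries, and assume x_i ≠ t·y_j for all 1 ≤ i, j ≤ n. Then ω(x, y; t) = ω(x^{−1}, y^{−1}; t^{−1}) · ∏_{i=1}^{n} y_i/x_i, where x^{−1} = (x_1^{−1}, …, x_n^{−1}) and y^{−1} = (y_1^{−1}, …, y_n^{−1}). -/
open Finset

lemma aux_pairs {n : ℕ} (I : Finset (Fin n)) :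
    ∑ i, ∑ j ∈ Ioi i, (if i ∈ I ∧ j ∈ I then 1 else 0 : ℕ) = I.card.choose 2 := by
  have h := Finset.sum_sum_Ioi_add_eq_sum_sum_off_diag
    (fun i j : Fin n => (if i ∈ I ∧ j ∈ I then 1 else 0 : ℕ))
  have h1 : ∀ i : Fin n, ∑ j ∈ ({i}ᶜ : Finset (Fin n)), (if j ∈ I ∧ i ∈ I then 1 else 0 : ℕ)
      = if i ∈ I then I.card - 1 else 0 := by
    intro i
    by_cases hi : i ∈ I
    · simp only [hi, and_true, if_true]
      rw [← Finset.sum_filter, ← Finset.card_erase_of_mem hi, Finset.card_eq_sum_ones]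
      congr 1
      ext j; simp
    · simp [hi]
  rw [Finset.sum_congr rfl (fun i _ => h1 i)] at h
  have h2 : ∀ i j : Fin n, ((if j ∈ I ∧ i ∈ I then 1 else 0 : ℕ) + (if i ∈ I ∧ j ∈ I then 1 else 0))
      = 2 * (if i ∈ I ∧ j ∈ I then 1 else 0) := by
    intro i j; by_cases hi : i ∈ I <;> by_cases hj : j ∈ I <;> simp [hi, hj]
  simp only [h2, ← Finset.mul_sum] at h
  rw [← Finset.sum_filter] at h
  simp only [Finset.sum_const, Finset.filter_univ_mem, smul_eq_mul] at h
  rw [Nat.choose_two_right]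
  omega

lemma aux_vand {K : Type*} [Field K] {n : ℕ} (t : K) (x : Fin n → K)
    (hx : Function.Injective x) (I : Finset (Fin n)) :
    (Matrix.projVandermonde x (fun i => if i ∈ I then t else 1)).det =
      t ^ (I.card.choose 2) * (∏ i ∈ I, ∏ j ∈ Iᶜ, (x i - t * x j) / (x i - x j)) *
        (Matrix.vandermonde x).det := by
  rw [Matrix.det_projVandermonde, Matrix.det_vandermonde]
  set w : Fin n → Fin n → K :=
    fun i j => if i ∈ I ∧ j ∈ Iᶜ then (x i - t * x j) / (x i - x j) else 1 with hw
  have h1 : ∏ i ∈ I, ∏ j ∈ Iᶜ, (x i - t * x j) / (x i - x j)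
      = ∏ i, ∏ j ∈ Ioi i, (w j i * w i j) := by
    rw [Finset.prod_prod_Ioi_mul_eq_prod_prod_off_diag]
    have : ∀ i, ∏ j ∈ ({i}ᶜ : Finset (Fin n)), w j i = ∏ j, w j i := by
      intro i
      apply Finset.prod_subset (Finset.subset_univ _)
      intro j _ hj
      have : j = i := by simpa using hj
      subst this
      simp [hw]
    simp only [this]
    rw [Finset.prod_comm (s := univ) (t := univ)]
    rw [← Finset.prod_filter_mul_prod_filter_not univ (· ∈ I) (fun i => ∏ j, w i j)]
    rw [Finset.prod_eq_one (s := univ.filter (fun i => ¬ i ∈ I)), mul_one]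
    · simp only [Finset.filter_univ_mem]
      refine Finset.prod_congr rfl fun i hi => ?_
      simp only [hw, hi, true_and]
      rw [← Finset.prod_filter]
      exact Finset.prod_congr (by ext; simp) fun _ _ => rfl
    · intro i hi
      have : i ∉ I := by simpa using hi
      simp [hw, this]
  rw [h1, ← aux_pairs, ← Finset.prod_pow_eq_pow_sum]
  simp only [← Finset.prod_pow_eq_pow_sum]
  rw [← Finset.prod_mul_distrib, ← Finset.prod_mul_distrib]
  refine Finset.prod_congr rfl fun i _ => ?_
  rw [← Finset.prod_mul_distrib, ← Finset.prod_mul_distrib]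
  refine Finset.prod_congr rfl fun j hj => ?_
  have hij : i ≠ j := ne_of_lt (by simpa using hj)
  have h3 : x i - x j ≠ 0 := sub_ne_zero.2 fun h => hij (hx h)
  have h4 : x j - x i ≠ 0 := sub_ne_zero.2 fun h => hij (hx h).symm
  by_cases hi : i ∈ I <;> by_cases hj : j ∈ I <;> simp [hw, hi, hj]
  · ring
  · field_simp
    ring
  · field_simp

lemma aux_det {K : Type*} [Field K] {n : ℕ} (t u : K) (x f : Fin n → K)
    (hx : Function.Injective x) :
    (Matrix.of fun i p : Fin n => x i ^ (p : ℕ) * (1 - u * t ^ (p.rev : ℕ) * f i)).det =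
      (∑ I : Finset (Fin n), (-1 : K) ^ I.card * t ^ (I.card.choose 2) * u ^ I.card *
        (∏ i ∈ I, ∏ j ∈ Iᶜ, (x i - t * x j) / (x i - x j)) * ∏ i ∈ I, f i) *
        (Matrix.vandermonde x).det := by
  have h0 := (Matrix.detRowAlternating (n := Fin n) (R := K)).map_add_univ
    (fun i p : Fin n => x i ^ (p : ℕ) * (- u * t ^ (p.rev : ℕ) * f i))
    (fun i p : Fin n => x i ^ (p : ℕ))
  have h1 : (Matrix.of fun i p : Fin n => x i ^ (p : ℕ) * (1 - u * t ^ (p.rev : ℕ) * f i)).det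
    = Matrix.detRowAlternating ((fun i p : Fin n => x i ^ (p : ℕ) * (- u * t ^ (p.rev : ℕ) * f i))
      + (fun i p : Fin n => x i ^ (p : ℕ))) := by
    change Matrix.det _ = Matrix.det _
    congr 1
    ext i p
    simp only [Matrix.of_apply, Pi.add_apply]
    ring
  rw [h1, h0, Finset.sum_mul]
  refine Finset.sum_congr rfl fun I _ => ?_
  have h2 : (I.piecewise (fun i p : Fin n => x i ^ (p : ℕ) * (- u * t ^ (p.rev : ℕ) * f i))
      (fun i p : Fin n => x i ^ (p : ℕ)) : Fin n → Fin n → K) =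
      Matrix.of fun i p => (if i ∈ I then - u * f i else 1) *
        Matrix.projVandermonde x (fun i => if i ∈ I then t else 1) i p := by
    ext i p
    by_cases hi : i ∈ I
    · simp [hi, Matrix.projVandermonde_apply]; ring
    · simp [hi, Matrix.projVandermonde_apply]
  rw [h2]
  change Matrix.det _ = _
  rw [Matrix.det_mul_column, aux_vand t x hx, Finset.prod_ite_mem, Finset.univ_inter,
    Finset.prod_mul_distrib, Finset.prod_const, neg_pow]
  ring

lemma aux_rot {K : Type*} [Field K] {m : ℕ} (t : K) (ht : t ≠ 0) (x y : Fin (m + 1) → K) :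
    (∏ i, y i) * (Matrix.of fun i p : Fin (m + 1) => x i ^ (p : ℕ) *
        ((∏ j, (x i - t * y j)) - t * t ^ (p.rev : ℕ) * ∏ j, (x i - y j))).det =
    (∏ i, x i) * (Matrix.of fun i p : Fin (m + 1) => x i ^ (p : ℕ) *
        ((∏ j, (x i - t * y j)) - t ^ (p.rev : ℕ) * ∏ j, (x i - y j))).det := by
  set P : Polynomial K := ∏ j, (Polynomial.X - Polynomial.C (y j)) with hP
  have hmon : P.Monic := Polynomial.monic_prod_of_monic _ _ fun j _ => Polynomial.monic_X_sub_C _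
  have hdeg : P.natDegree = m + 1 := by
    rw [hP, Polynomial.natDegree_prod_of_monic _ _ fun j _ => Polynomial.monic_X_sub_C _]
    simp
  have hc : P.coeff (m + 1) = 1 := by rw [← hdeg]; exact hmon.coeff_natDegree
  have hc0 : P.coeff 0 = (-1) ^ (m + 1) * ∏ i, y i := by
    rw [Polynomial.coeff_zero_eq_eval_zero, hP, Polynomial.eval_prod]
    simp [Finset.prod_neg]
  have hPe : ∀ z, ∏ j, (z - y j) = ∑ k ∈ range (m + 1), P.coeff k * z ^ k + z ^ (m + 1) := by
    intro z
    have := Polynomial.eval_eq_sum_range (p := P) z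
    rw [hdeg, Finset.sum_range_succ, hc, one_mul] at this
    rw [← this, hP, Polynomial.eval_prod]; simp
  have hQe : ∀ z, ∏ j, (z - t * y j) =
      ∑ k ∈ range (m + 1), P.coeff k * (t ^ (m + 1 - k) * z ^ k) + z ^ (m + 1) := by
    intro z
    have h1 : ∏ j, (z - t * y j) = t ^ (m + 1) * ∏ j, (z / t - y j) := by
      have : ∀ j, z - t * y j = t * (z / t - y j) := fun j => by field_simp
      simp only [this, Finset.prod_mul_distrib]
      simp
    rw [h1, hPe, mul_add, Finset.mul_sum]
    congr 1
    · refine Finset.sum_congr rfl fun k hk => ?_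
      have hk : k ≤ m + 1 := (Finset.mem_range.1 hk).le
      rw [div_pow, ← Nat.sub_add_cancel hk, pow_add, Nat.add_sub_cancel_right]
      field_simp
    · rw [← mul_pow, mul_div_cancel₀ _ ht]
  set Pv : Fin (m + 1) → K := fun i => ∏ j, (x i - y j) with hPv
  set Qv : Fin (m + 1) → K := fun i => ∏ j, (x i - t * y j) with hQv
  set H := (Matrix.of fun i p : Fin (m + 1) => x i ^ (p : ℕ) *
        (Qv i - t * t ^ (p.rev : ℕ) * Pv i)) with hH
  set G := (Matrix.of fun i p : Fin (m + 1) => x i ^ (p : ℕ) *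
        (Qv i - t ^ (p.rev : ℕ) * Pv i)) with hG
  change _ * H.det = _ * G.det
  -- linear relation
  have hrel : ∀ i, ∑ p : Fin (m + 1), P.coeff p * H i p = x i ^ (m + 1) * (Pv i - Qv i) := by
    intro i
    have e1 : ∑ p : Fin (m + 1), P.coeff p * H i p =
        (∑ k ∈ range (m + 1), P.coeff k * x i ^ k) * Qv i
        - (∑ k ∈ range (m + 1), P.coeff k * (t ^ (m + 1 - k) * x i ^ k)) * Pv i := by
      rw [Finset.sum_mul, Finset.sum_mul, ← Finset.sum_sub_distrib, Finset.sum_range]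
      refine Finset.sum_congr rfl fun p _ => ?_
      have : m + 1 - (p : ℕ) = (p.rev : ℕ) + 1 := by
        rw [Fin.val_rev]; have := p.2; omega
      rw [this, hH, Matrix.of_apply, pow_succ]
      ring
    have a := hPe (x i)
    have b := hQe (x i)
    change Pv i = _ at a
    change Qv i = _ at b
    rw [e1, ← sub_eq_iff_eq_add.2 a, ← sub_eq_iff_eq_add.2 b]
    ring
  have hsucc : ∀ i (p : Fin m), H i p.succ = x i * G i p.castSucc := by
    intro i p
    have : ((p.castSucc).rev : ℕ) = (p.succ.rev : ℕ) + 1 := by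
      simp only [Fin.val_rev, Fin.val_castSucc, Fin.val_succ]; have := p.2; omega
    simp only [hH, hG, Matrix.of_apply, this, Fin.val_succ, Fin.val_castSucc, pow_succ]
    ring
  have hlast : ∀ i, x i ^ (m + 1) * (Pv i - Qv i) = - (x i * G i (Fin.last m)) := by
    intro i
    simp only [hG, Matrix.of_apply, Fin.rev_last, Fin.val_last, Fin.val_zero, pow_succ, pow_zero]
    ring
  set XG := (Matrix.of fun i p : Fin (m + 1) => x i * G i p) with hXG
  set c : Fin (m + 1) → K := fun p => - P.coeff (p + 1) with hcdef
  have key := Matrix.det_updateCol_sum XG (Fin.last m) c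
  have e2 : XG.updateCol (Fin.last m) (fun k => ∑ i, c i • XG k i) =
      (H.submatrix id (finRotate (m + 1))).updateCol (Fin.last m)
        (P.coeff 0 • fun i => H i 0) := by
    ext i p
    refine Fin.lastCases ?_ (fun p => ?_) p
    · simp only [Matrix.updateCol_self, Pi.smul_apply, smul_eq_mul]
      have h := hrel i
      rw [Fin.sum_univ_succ, hlast] at h
      rw [Fin.sum_univ_castSucc]
      simp only [hsucc, Fin.val_succ, Fin.val_zero] at h
      have e3 : P.coeff 0 * H i 0 = - (x i * G i (Fin.last m))
        - ∑ p : Fin m, P.coeff (p + 1) * (x i * G i p.castSucc) := by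
        rw [← h]; ring
      rw [e3]
      simp only [hcdef, hXG, Matrix.of_apply, Fin.val_castSucc, Fin.val_last, hc, neg_mul,
        Finset.sum_neg_distrib, one_mul]
      ring
    · rw [Matrix.updateCol_ne (Fin.castSucc_lt_last p).ne,
        Matrix.updateCol_ne (Fin.castSucc_lt_last p).ne]
      simp [hXG, hsucc]
  rw [e2, Matrix.det_updateCol_smul] at key
  have e4 : (H.submatrix id (finRotate (m + 1))).updateCol (Fin.last m) (fun i => H i 0)
      = H.submatrix id (finRotate (m + 1)) := by
    ext i p
    refine Fin.lastCases ?_ (fun p => ?_) p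
    · simp
    · rw [Matrix.updateCol_ne (Fin.castSucc_lt_last p).ne]
  rw [e4, Matrix.det_permute', sign_finRotate, hXG, Matrix.det_mul_column, hc0] at key
  simp only [hcdef, Fin.val_last, hc, smul_eq_mul] at key
  have e5 : ((-1 : K) ^ m) * (-1) ^ m = 1 := by rw [← mul_pow]; simp
  push_cast at key
  simp only [pow_succ] at key
  linear_combination -key - (∏ i, y i) * H.det * e5

/-- The inversion symmetry `ω(x,y;t) = ω(x⁻¹,y⁻¹;t⁻¹) · ∏ y_i/x_i` for `m = n`. -/
theorem bisymOmega_inv {K : Type*} [Field K] {n : ℕ} (hn : 0 < n) (t : K) (ht : t ≠ 0)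
    (x y : Fin n → K)
    (hx : Function.Injective x) (hy : Function.Injective y)
    (hx0 : ∀ i, x i ≠ 0) (hy0 : ∀ i, y i ≠ 0)
    (hxy : ∀ i j : Fin n, x i ≠ t * y j) :
    bisymOmega t x y =
      bisymOmega t⁻¹ (fun i => (x i)⁻¹) (fun i => (y i)⁻¹) * ∏ i, y i / x i := by
  obtain ⟨m, rfl⟩ : ∃ m, n = m + 1 := ⟨n - 1, by omega⟩
  have hV : (Matrix.vandermonde x).det ≠ 0 := Matrix.det_vandermonde_ne_zero_iff.2 hx
  have hQ : ∀ i, ∏ j, (x i - t * y j) ≠ 0 := fun i =>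
    Finset.prod_ne_zero_iff.2 fun j _ => sub_ne_zero.2 (hxy i j)
  set f : Fin (m + 1) → K := fun i => ∏ j, (x i - y j) / (x i - t * y j) with hf
  have hfQ : ∀ i, (∏ j, (x i - t * y j)) * f i = ∏ j, (x i - y j) := by
    intro i
    rw [hf]
    simp only [Finset.prod_div_distrib]
    field_simp [hQ i]
  have hrows : ∀ u, (∏ i, ∏ j, (x i - t * y j)) *
      (Matrix.of fun i p : Fin (m + 1) => x i ^ (p : ℕ) * (1 - u * t ^ (p.rev : ℕ) * f i)).det
      = (Matrix.of fun i p : Fin (m + 1) => x i ^ (p : ℕ) *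
        ((∏ j, (x i - t * y j)) - u * t ^ (p.rev : ℕ) * ∏ j, (x i - y j))).det := by
    intro u
    rw [← Matrix.det_mul_column]
    congr 1
    ext i p
    simp only [Matrix.of_apply]
    rw [← hfQ i]
    ring
  have h1 := hrows 1
  have ht' := hrows t
  rw [aux_det t _ x f hx] at h1 ht'
  have hrot := aux_rot t ht x y
  rw [← ht'] at hrot
  simp only [one_mul] at h1
  rw [← h1] at hrot
  have w1 : bisymOmega t x y = ∑ I : Finset (Fin (m + 1)), (-1 : K) ^ I.card *
      t ^ (I.card.choose 2) * 1 ^ I.card *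
        (∏ i ∈ I, ∏ j ∈ Iᶜ, (x i - t * x j) / (x i - x j)) * ∏ i ∈ I, f i := by
    simp [bisymOmega, hf]
  have w2 : bisymOmega t⁻¹ (fun i => (x i)⁻¹) (fun i => (y i)⁻¹) =
      ∑ I : Finset (Fin (m + 1)), (-1 : K) ^ I.card * t ^ (I.card.choose 2) * t ^ I.card *
        (∏ i ∈ I, ∏ j ∈ Iᶜ, (x i - t * x j) / (x i - x j)) * ∏ i ∈ I, f i := by
    unfold bisymOmega
    refine Finset.sum_congr rfl fun I _ => ?_
    have a1 : ∏ i ∈ I, ∏ j ∈ Iᶜ, ((x i)⁻¹ - t⁻¹ * (x j)⁻¹) / ((x i)⁻¹ - (x j)⁻¹) =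
        ∏ i ∈ I, ∏ j ∈ Iᶜ, (t⁻¹ * ((x i - t * x j) / (x i - x j))) := by
      refine Finset.prod_congr rfl fun i hi => Finset.prod_congr rfl fun j hj => ?_
      have hij : i ≠ j := fun h => (Finset.mem_compl.1 hj) (h ▸ hi)
      have h3 : x i - x j ≠ 0 := sub_ne_zero.2 fun h => hij (hx h)
      have h4 : (x i)⁻¹ - (x j)⁻¹ ≠ 0 := sub_ne_zero.2 fun h => hij (hx (inv_injective h))
      have := hx0 i
      have := hx0 j
      rw [div_eq_iff h4]
      field_simp
      ring
    have a2 : ∏ i ∈ I, ∏ j, ((x i)⁻¹ - (y j)⁻¹) / ((x i)⁻¹ - t⁻¹ * (y j)⁻¹) =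
        ∏ i ∈ I, ∏ j, (t * ((x i - y j) / (x i - t * y j))) := by
      refine Finset.prod_congr rfl fun i hi => Finset.prod_congr rfl fun j hj => ?_
      have h3 : x i - t * y j ≠ 0 := sub_ne_zero.2 (hxy i j)
      have h4 : (x i)⁻¹ - t⁻¹ * (y j)⁻¹ ≠ 0 := sub_ne_zero.2 fun h => hxy i j (by
        rw [← mul_inv] at h; exact inv_injective h)
      have := hx0 i
      have := hy0 j
      rw [div_eq_iff h4, mul_div_assoc', div_mul_eq_mul_div, eq_div_iff h3]
      field_simp
      ring
    rw [a1, a2]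
    simp only [Finset.prod_mul_distrib, Finset.prod_const, Finset.card_univ, Fintype.card_fin,
      Finset.card_compl]
    have hk : I.card ≤ m + 1 := by simpa using Finset.card_le_univ I
    have e : t⁻¹ ^ (I.card.choose 2) * (t⁻¹ ^ (m + 1 - I.card)) ^ I.card * (t ^ (m + 1)) ^ I.card
        = t ^ (I.card.choose 2) * t ^ I.card := by
      have hch : 2 * I.card.choose 2 + I.card = I.card * I.card := by
        generalize I.card = k
        induction k with
        | zero => simp
        | succ k ih => rw [Nat.choose_succ_succ' k 1, Nat.choose_one_right]; nlinarith
      obtain ⟨r, hr⟩ := Nat.exists_eq_add_of_le hk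
      have hr' : m + 1 - I.card = r := by omega
      rw [hr']
      generalize I.card = k at *
      rw [hr]
      simp only [inv_pow, ← pow_mul]
      field_simp
      rw [← pow_mul, ← pow_add, ← pow_add]
      congr 1
      nlinarith
    linear_combination ((-1 : K) ^ I.card *
      (∏ i ∈ I, ∏ j ∈ Iᶜ, (x i - t * x j) / (x i - x j)) * ∏ i ∈ I, f i) * e
  rw [← w1, ← w2] at hrot
  have hX : ∏ i, x i ≠ 0 := Finset.prod_ne_zero_iff.2 fun i _ => hx0 i
  have hQQ : ∏ i, ∏ j, (x i - t * y j) ≠ 0 := Finset.prod_ne_zero_iff.2 fun i _ => hQ i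
  rw [Finset.prod_div_distrib, mul_div_assoc', eq_div_iff hX]
  apply mul_right_cancel₀ (mul_ne_zero hQQ hV)
  linear_combination -hrot
end
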